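/- arXiv:1603.02239 — 2 statements merged into one kernel-verified Lean document; each statement's English description precedes it below -/
import Mathlib

section
/- Under the full assumptions and Algorithm 1, for every minimizer x* ∈ X*: liminf_{k→∞} ∑_{i=1}^m ( f_i(v̄(k+1)) − f_i(x*) ) = 0. -/
open Filter Finset Metric
open scoped Topology BigOperators

/-- Three-point inequality for the proximal step of a convex function over a convex set. -/
theorem prox_three_point {E : Type*} [NormedAddCommGroup E] [InnerProductSpace ℝ E]
    {s : Set E} {f : E → ℝ} (hf : ConvexOn ℝ s f) {c : ℝ} (hc : 0 < c) {z p y : E}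
    (hp : p ∈ s) (hy : y ∈ s)
    (hmin : ∀ w ∈ s, f p + (1 / (2 * c)) * ‖z - p‖ ^ 2 ≤ f w + (1 / (2 * c)) * ‖z - w‖ ^ 2) :
    2 * c * (f p - f y) + ‖p - z‖ ^ 2 + ‖p - y‖ ^ 2 ≤ ‖z - y‖ ^ 2 := by
  have segment_ineq : ∀ t : ℝ, 0 < t → t ≤ 1 →
      2 * c * (f p - f y) + 2 * inner ℝ (z - p) (y - p) ≤ t * ‖y - p‖ ^ 2 := by
    intro t ht ht1
    have hmem := hf.1 hp hy (sub_nonneg.2 ht1) ht.le (by ring)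
    have hconv := hf.2 hp hy (sub_nonneg.2 ht1) ht.le (by ring)
    have hle := hmin _ hmem
    have hz : z - ((1 - t) • p + t • y) = (z - p) - t • (y - p) := by module
    rw [hz, norm_sub_sq_real (z - p) (t • (y - p)), inner_smul_right, norm_smul, mul_pow,
      Real.norm_eq_abs, sq_abs] at hle
    simp only [smul_eq_mul] at hconv
    have hscaled : 0 ≤ 2 * c * (t * (f y - f p) +
        (1 / (2 * c)) * (t ^ 2 * ‖y - p‖ ^ 2 - 2 * (t * inner ℝ (z - p) (y - p)))) := by
      apply mul_nonneg (by positivity)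
      linarith
    have hexp : 2 * c * (t * (f y - f p) +
        (1 / (2 * c)) * (t ^ 2 * ‖y - p‖ ^ 2 - 2 * (t * inner ℝ (z - p) (y - p)))) =
        t * (t * ‖y - p‖ ^ 2 - (2 * c * (f p - f y) + 2 * inner ℝ (z - p) (y - p))) := by
      field_simp
      ring
    rw [hexp] at hscaled
    linarith [nonneg_of_mul_nonneg_right hscaled ht]
  have hlim : 2 * c * (f p - f y) + 2 * inner ℝ (z - p) (y - p) ≤ 0 := by
    have htend : Tendsto (fun t : ℝ => t * ‖y - p‖ ^ 2) (𝓝[>] 0) (𝓝 0) := by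
      have : ContinuousAt (fun t : ℝ => t * ‖y - p‖ ^ 2) 0 := by fun_prop
      simpa using this.tendsto.mono_left nhdsWithin_le_nhds
    refine ge_of_tendsto htend ?_
    filter_upwards [Ioc_mem_nhdsGT (zero_lt_one' ℝ)] with t ht
    exact segment_ineq t ht.1 ht.2
  have hsq : ‖z - y‖ ^ 2 = ‖z - p‖ ^ 2 - 2 * inner ℝ (z - p) (y - p) + ‖y - p‖ ^ 2 := by
    rw [← norm_sub_sq_real]
    congr 2
    abel
  rw [norm_sub_rev p z, norm_sub_rev p y]
  linarith

/-- Bias-variance decomposition for a weighted mean. -/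
theorem sum_weight_mul_norm_sub_sq {ι E : Type*} [Fintype ι] [NormedAddCommGroup E]
    [InnerProductSpace ℝ E] (w : ι → ℝ) (hw : ∑ j, w j = 1) (x : ι → E) (y : E) :
    ∑ j, w j * ‖x j - y‖ ^ 2 =
      ‖∑ j, w j • x j - y‖ ^ 2 + ∑ j, w j * ‖x j - ∑ l, w l • x l‖ ^ 2 := by
  set z := ∑ l, w l • x l with hz
  have hexp : ∀ j, w j * ‖x j - y‖ ^ 2 =
      w j * ‖x j - z‖ ^ 2 + 2 * inner ℝ (w j • (x j - z)) (z - y) + w j * ‖z - y‖ ^ 2 := by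
    intro j
    have : x j - y = (x j - z) + (z - y) := by abel
    rw [this, norm_add_sq_real, inner_smul_left]
    simp
    ring
  have hcenter : ∑ j, w j • (x j - z) = 0 := by
    simp [smul_sub, Finset.sum_sub_distrib, ← Finset.sum_smul, hw, hz]
  simp_rw [hexp, Finset.sum_add_distrib, ← Finset.mul_sum, ← sum_inner, hcenter,
    ← Finset.sum_mul, hw]
  simp
  ring

/-- Pulling a point `v` towards the centre of a ball inside a closed convex set `s`, by an amount
governed by an upper bound `ε` on the distance from `v` to `s`, lands in `s`. -/
theorem combo_center_mem {E : Type*} [NormedAddCommGroup E] [NormedSpace ℝ E]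
    {s : Set E} (hs : Convex ℝ s) (hcpt : IsCompact s) {xbar : E} {ρ : ℝ} (hρ : 0 < ρ)
    (hball : ball xbar ρ ⊆ s) {v : E} {ε : ℝ} (hε : infDist v s ≤ ε) :
    (ε / (ε + ρ)) • xbar + (ρ / (ε + ρ)) • v ∈ s := by
  have hxs : xbar ∈ s := hball (mem_ball_self hρ)
  obtain ⟨p, hps, hp⟩ := hcpt.exists_infDist_eq_dist ⟨_, hxs⟩ v
  have hε0 : 0 ≤ ε := infDist_nonneg.trans hε
  have hvp : ‖v - p‖ ≤ ε := by rw [← dist_eq_norm, ← hp]; exact hε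
  rcases hε0.eq_or_lt with rfl | hpos
  · have : v = p := sub_eq_zero.1 (norm_le_zero_iff.1 hvp)
    simpa [this, hρ.ne'] using hps
  have hclosed : closedBall xbar ρ ⊆ s := by
    rw [← closure_ball xbar hρ.ne']
    exact hcpt.isClosed.closure_subset_iff.2 hball
  have hq : xbar + (ρ / ε) • (v - p) ∈ s := by
    apply hclosed
    rw [mem_closedBall, dist_eq_norm, add_sub_cancel_left, norm_smul, Real.norm_of_nonneg
      (by positivity), div_mul_eq_mul_div, div_le_iff₀ hpos]
    gcongr
  have hmem := hs hq hps (a := ε / (ε + ρ)) (b := ρ / (ε + ρ)) (by positivity) (by positivity)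
    (by field_simp)
  convert hmem using 1
  have : ε / (ε + ρ) * (ρ / ε) = ρ / (ε + ρ) := by field_simp
  rw [smul_add, smul_smul, this]
  module

theorem dist_combo_center_le {E : Type*} [NormedAddCommGroup E] [NormedSpace ℝ E]
    {xbar v : E} {ρ ε : ℝ} (hρ : 0 < ρ) (hε : 0 ≤ ε) :
    ‖(ε / (ε + ρ)) • xbar + (ρ / (ε + ρ)) • v - v‖ ≤ ε / ρ * ‖xbar - v‖ := by
  have hcoef : ρ / (ε + ρ) = 1 - ε / (ε + ρ) := by field_simp; ring
  have : (ε / (ε + ρ)) • xbar + (ρ / (ε + ρ)) • v - v = (ε / (ε + ρ)) • (xbar - v) := by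
    rw [hcoef]; module
  rw [this, norm_smul, Real.norm_of_nonneg (by positivity)]
  gcongr
  linarith

/-- A nonnegative sequence whose sums against a divergent positive series are bounded has
lower limit zero. -/
theorem liminf_eq_zero_of_sum_mul_le {c u : ℕ → ℝ} (hc : ∀ k, 0 < c k)
    (hdiv : Tendsto (fun N => ∑ k ∈ range N, c k) atTop atTop) (hu : ∀ k, 0 ≤ u k)
    {K : ℝ} (hK : ∀ N, ∑ k ∈ range N, c k * u k ≤ K) : liminf u atTop = 0 := by
  have hfreq : ∀ ε > 0, ∃ᶠ k in atTop, u k ≤ ε := by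
    intro ε hε hev
    obtain ⟨N₀, hN₀⟩ := eventually_atTop.1 hev
    obtain ⟨N, hN, hN'⟩ := ((hdiv.eventually_gt_atTop
      (K / ε + ∑ k ∈ range N₀, c k)).and (eventually_ge_atTop N₀)).exists
    have hsum : ε * ∑ k ∈ Ico N₀ N, c k ≤ ∑ k ∈ range N, c k * u k := by
      rw [← Finset.sum_range_add_sum_Ico _ hN', Finset.mul_sum]
      have h1 : 0 ≤ ∑ k ∈ range N₀, c k * u k :=
        Finset.sum_nonneg fun k _ => mul_nonneg (hc k).le (hu k)
      have h2 : ∑ k ∈ Ico N₀ N, ε * c k ≤ ∑ k ∈ Ico N₀ N, c k * u k := by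
        refine Finset.sum_le_sum fun k hk => ?_
        rw [mul_comm]
        exact mul_le_mul_of_nonneg_left (not_le.1 (hN₀ k (Finset.mem_Ico.1 hk).1)).le (hc k).le
      linarith
    rw [← Finset.sum_range_add_sum_Ico _ hN'] at hN
    have h3 : K / ε < ∑ k ∈ Ico N₀ N, c k := by linarith
    rw [div_lt_iff₀' hε] at h3
    linarith [hK N]
  have hbdd : IsBoundedUnder (· ≥ ·) atTop u := isBoundedUnder_of ⟨0, hu⟩
  apply le_antisymm
  · exact le_of_forall_pos_le_add fun ε hε => by
      simpa using liminf_le_of_frequently_le (hfreq ε hε) hbdd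
  · exact le_liminf_of_le (IsCoboundedUnder.of_frequently_le (hfreq 1 one_pos))
      (Eventually.of_forall hu)

theorem ConvexOn.exists_abs_sub_le_of_isCompact {E : Type*} [NormedAddCommGroup E]
    [NormedSpace ℝ E] [FiniteDimensional ℝ E] {f : E → ℝ} (hf : ConvexOn ℝ Set.univ f)
    {s : Set E} (hs : IsCompact s) :
    ∃ L : ℝ, 0 ≤ L ∧ ∀ x ∈ s, ∀ y ∈ s, |f x - f y| ≤ L * ‖x - y‖ := by
  obtain ⟨L, hL⟩ := hf.locallyLipschitz.locallyLipschitzOn.exists_lipschitzOnWith_of_compact hs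
  refine ⟨L, L.2, fun x hx y hy => ?_⟩
  simpa [Real.dist_eq, dist_eq_norm] using hL.dist_le_mul x hx y hy

/-- If one-step moves are controlled by `h`, and within every window of length `T` each edge of a
strongly connected graph sees its endpoints `h`-close, then all disagreements are controlled by the
sum of `h` over the window. -/
theorem exists_norm_sub_le_sum_window {ι E : Type*} [Fintype ι] [NormedAddCommGroup E]
    (x : ι → ℕ → E) (h : ℕ → ℝ) (hh : ∀ k, 0 ≤ h k) (T : ℕ) (r : ι → ι → Prop)
    (hr : ∀ i j, Relation.ReflTransGen r i j)
    (hstep : ∀ i k, ‖x i (k + 1) - x i k‖ ≤ h k)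
    (hedge : ∀ j i, r j i → ∀ k, ∃ l, k ≤ l ∧ l < k + T ∧ ‖x j l - x i l‖ ≤ h l) :
    ∃ C : ℝ, ∀ i j k, ‖x i k - x j k‖ ≤ C * ∑ l ∈ range T, h (k + l) := by
  have hH : ∀ k, 0 ≤ ∑ l ∈ range T, h (k + l) := fun k => Finset.sum_nonneg fun l _ => hh _
  have hdrift : ∀ i k s, ‖x i (k + s) - x i k‖ ≤ ∑ l ∈ range s, h (k + l) := by
    intro i k s
    induction s with
    | zero => simp
    | succ s ih =>
      rw [Finset.sum_range_succ]
      calc ‖x i (k + (s + 1)) - x i k‖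
          = ‖(x i (k + s) - x i k) + (x i (k + s + 1) - x i (k + s))‖ := by
            congr 1; rw [← add_assoc]; abel
        _ ≤ _ := (norm_add_le _ _).trans (add_le_add ih (hstep i (k + s)))
  have hadj : ∀ j i, r j i → ∀ k, ‖x j k - x i k‖ ≤ 3 * ∑ l ∈ range T, h (k + l) := by
    intro j i hji k
    obtain ⟨l, hkl, hlT, hl⟩ := hedge j i hji k
    obtain ⟨s, rfl⟩ := Nat.exists_eq_add_of_le hkl
    have hsT : s < T := by omega
    have hsum : ∑ l ∈ range s, h (k + l) ≤ ∑ l ∈ range T, h (k + l) :=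
      Finset.sum_le_sum_of_subset_of_nonneg (Finset.range_subset_range.2 hsT.le) fun _ _ _ => hh _
    have hterm : h (k + s) ≤ ∑ l ∈ range T, h (k + l) :=
      Finset.single_le_sum (f := fun l => h (k + l)) (fun _ _ => hh _) (Finset.mem_range.2 hsT)
    have htri : ‖x j k - x i k‖ ≤
        ‖x j (k + s) - x j k‖ + ‖x j (k + s) - x i (k + s)‖ + ‖x i (k + s) - x i k‖ := by
      have : x j k - x i k =
          -(x j (k + s) - x j k) + (x j (k + s) - x i (k + s)) + (x i (k + s) - x i k) := by abel
      rw [this, ← norm_neg (x j (k + s) - x j k)]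
      exact norm_add₃_le
    linarith [hdrift j k s, hdrift i k s]
  have hpair : ∀ i j, ∃ C : ℝ, 0 ≤ C ∧
      ∀ k, ‖x i k - x j k‖ ≤ C * ∑ l ∈ range T, h (k + l) := by
    intro i j
    induction hr i j with
    | refl => exact ⟨0, le_rfl, by simp⟩
    | @tail b d _ hbd ih =>
      obtain ⟨C, hC, hCk⟩ := ih
      refine ⟨C + 3, by positivity, fun k => ?_⟩
      have := norm_sub_le_norm_sub_add_norm_sub (x i k) (x b k) (x d k)
      linarith [hCk k, hadj b d hbd k]
  choose C hC hCk using hpair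
  refine ⟨∑ i, ∑ j, C i j, fun i j k => (hCk i j k).trans (mul_le_mul_of_nonneg_right ?_ (hH k))⟩
  calc C i j ≤ ∑ j, C i j := Finset.single_le_sum (fun j _ => hC i j) (Finset.mem_univ j)
    _ ≤ _ := Finset.single_le_sum (f := fun i => ∑ j, C i j)
      (fun i _ => Finset.sum_nonneg fun j _ => hC i j) (Finset.mem_univ i)

theorem sum_range_sum_window_le {g : ℕ → ℝ} {G : ℝ} (hg : ∀ k, 0 ≤ g k) (hG : ∀ k, g k ≤ G)
    (T N : ℕ) :
    ∑ k ∈ range N, ∑ l ∈ range T, g (k + 1 + l) ≤ T * (∑ k ∈ range N, g k + T * G) := by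
  have hG0 : 0 ≤ G := (hg 0).trans (hG 0)
  rw [Finset.sum_comm]
  have hshift : ∀ l ∈ range T, ∑ k ∈ range N, g (k + 1 + l) ≤ ∑ k ∈ range N, g k + T * G := by
    intro l hl
    have hlT : l + 1 ≤ T := Finset.mem_range.1 hl
    calc ∑ k ∈ range N, g (k + 1 + l)
        ≤ ∑ k ∈ range (l + 1), g k + ∑ k ∈ range N, g (l + 1 + k) := by
          have : ∀ k, g (k + 1 + l) = g (l + 1 + k) := fun k => by congr 1; omega
          simp_rw [this]
          linarith [Finset.sum_nonneg fun k (_ : k ∈ range (l + 1)) => hg k]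
      _ = ∑ k ∈ range N, g k + ∑ k ∈ range (l + 1), g (N + k) := by
          rw [← Finset.sum_range_add, ← Finset.sum_range_add, add_comm]
      _ ≤ ∑ k ∈ range N, g k + T * G := by
          gcongr
          calc ∑ k ∈ range (l + 1), g (N + k) ≤ ∑ _k ∈ range (l + 1), G :=
                Finset.sum_le_sum fun k _ => hG _
            _ = ((l + 1 : ℕ) : ℝ) * G := by simp
            _ ≤ T * G := by gcongr
  simpa [mul_add] using Finset.sum_le_card_nsmul _ _ _ hshift

/-- A perturbed descent recursion whose error `w` is dominated in mean square by the gains `g` over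
a bounded window ahead has bounded weighted sums. -/
theorem exists_sum_mul_le_of_descent {V c g u w : ℕ → ℝ} {B G : ℝ} {T : ℕ}
    (hV : ∀ k, 0 ≤ V k) (hg : ∀ k, 0 ≤ g k) (hG : ∀ k, g k ≤ G) (hB : 0 ≤ B)
    (hc : Summable fun k => c k ^ 2)
    (hdesc : ∀ k, 2 * c k * u k + g k + V (k + 1) ≤ V k + 2 * c k * w k)
    (hw : ∀ k, w k ^ 2 ≤ B * ∑ l ∈ range T, g (k + 1 + l)) :
    ∃ K, ∀ N, ∑ k ∈ range N, c k * u k ≤ K := by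
  set A : ℝ := B * T + 1 with hA
  have hApos : 0 < A := by positivity
  have hG0 : 0 ≤ G := (hg 0).trans (hG 0)
  have hyoung : ∀ k, 2 * c k * w k ≤ A * c k ^ 2 + B / A * ∑ l ∈ range T, g (k + 1 + l) := by
    intro k
    have h1 : 2 * c k * w k ≤ A * c k ^ 2 + w k ^ 2 / A := by
      have : A * c k ^ 2 + w k ^ 2 / A - 2 * c k * w k = (A * c k - w k) ^ 2 / A := by
        field_simp
        ring
      have : 0 ≤ (A * c k - w k) ^ 2 / A := by positivity
      linarith
    have h2 : w k ^ 2 / A ≤ B / A * ∑ l ∈ range T, g (k + 1 + l) := by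
      rw [div_mul_eq_mul_div]
      gcongr
      exact hw k
    linarith
  have hacc : ∀ N, 2 * ∑ k ∈ range N, c k * u k + ∑ k ∈ range N, g k + V N ≤
      V 0 + A * ∑ k ∈ range N, c k ^ 2 +
        B / A * ∑ k ∈ range N, ∑ l ∈ range T, g (k + 1 + l) := by
    intro N
    induction N with
    | zero => simp
    | succ N ih =>
      simp only [Finset.sum_range_succ _ N, mul_add]
      linarith [hdesc N, hyoung N]
  refine ⟨(V 0 + A * ∑' k, c k ^ 2 + T * G) / 2, fun N => ?_⟩
  have hsq : A * ∑ k ∈ range N, c k ^ 2 ≤ A * ∑' k, c k ^ 2 := by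
    gcongr
    exact hc.sum_le_tsum _ fun k _ => sq_nonneg _
  have hwin : B / A * ∑ k ∈ range N, ∑ l ∈ range T, g (k + 1 + l) ≤
      ∑ k ∈ range N, g k + T * G := by
    have hnn : 0 ≤ ∑ k ∈ range N, g k + T * G :=
      add_nonneg (Finset.sum_nonneg fun k _ => hg k) (by positivity)
    calc B / A * ∑ k ∈ range N, ∑ l ∈ range T, g (k + 1 + l)
        ≤ B / A * (T * (∑ k ∈ range N, g k + T * G)) := by
          gcongr
          exact sum_range_sum_window_le hg hG T N
      _ = B * T / A * (∑ k ∈ range N, g k + T * G) := by ring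
      _ ≤ 1 * (∑ k ∈ range N, g k + T * G) := by
          gcongr
          rw [div_le_one hApos]
          linarith
      _ = _ := one_mul _
  linarith [hacc N, hV N]

/-- One round of averaging followed by proximal steps decreases the total squared distance to any
common feasible point, up to the change of objective value. -/
theorem sum_prox_descent {ι E : Type*} [Fintype ι] [NormedAddCommGroup E] [InnerProductSpace ℝ E]
    {X : ι → Set E} (hX : ∀ i, Convex ℝ (X i)) {f : ι → E → ℝ}
    (hf : ∀ i, ConvexOn ℝ Set.univ (f i)) {w : ι → ι → ℝ} (hrow : ∀ i, ∑ j, w i j = 1)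
    (hcol : ∀ j, ∑ i, w i j = 1) {c : ℝ} (hc : 0 < c) {x p z : ι → E}
    (hz : ∀ i, z i = ∑ j, w i j • x j) (hp : ∀ i, p i ∈ X i)
    (hmin : ∀ i, ∀ y ∈ X i,
      f i (p i) + (1 / (2 * c)) * ‖z i - p i‖ ^ 2 ≤ f i y + (1 / (2 * c)) * ‖z i - y‖ ^ 2)
    {y : E} (hy : ∀ i, y ∈ X i) :
    2 * c * ∑ i, (f i (p i) - f i y) +
        ∑ i, (‖p i - z i‖ ^ 2 + ∑ j, w i j * ‖x j - z i‖ ^ 2) + ∑ i, ‖p i - y‖ ^ 2 ≤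
      ∑ i, ‖x i - y‖ ^ 2 := by
  have hstep : ∀ i, 2 * c * (f i (p i) - f i y) +
      (‖p i - z i‖ ^ 2 + ∑ j, w i j * ‖x j - z i‖ ^ 2) + ‖p i - y‖ ^ 2 ≤
        ∑ j, w i j * ‖x j - y‖ ^ 2 := by
    intro i
    rw [sum_weight_mul_norm_sub_sq (w i) (hrow i) x y, ← hz i]
    linarith [prox_three_point ((hf i).subset (Set.subset_univ _) (hX i)) hc (hp i) (hy i) (hmin i)]
  have hdouble : ∑ i, ∑ j, w i j * ‖x j - y‖ ^ 2 = ∑ j, ‖x j - y‖ ^ 2 := by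
    rw [Finset.sum_comm]
    simp_rw [← Finset.sum_mul, hcol, one_mul]
  have hsum := Finset.sum_le_sum fun i (_ : i ∈ Finset.univ) => hstep i
  rw [hdouble] at hsum
  simpa only [Finset.sum_add_distrib, ← Finset.mul_sum] using hsum

theorem norm_sub_mean_le {E : Type*} [NormedAddCommGroup E] [NormedSpace ℝ E] {m : ℕ}
    (hm : 0 < m) {x : Fin m → E} {p : E} {D : ℝ} (hD : ∀ j, ‖x j - p‖ ≤ D) :
    ‖(m : ℝ)⁻¹ • ∑ j, x j - p‖ ≤ D := by
  have hm' : (m : ℝ) ≠ 0 := by positivity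
  have hrw : (m : ℝ)⁻¹ • ∑ j, x j - p = (m : ℝ)⁻¹ • ∑ j, (x j - p) := by
    rw [Finset.sum_sub_distrib, smul_sub]
    simp [← Nat.cast_smul_eq_nsmul ℝ, smul_smul, hm']
  rw [hrw, norm_smul, Real.norm_of_nonneg (by positivity), inv_mul_le_iff₀ (by positivity)]
  calc ‖∑ j, (x j - p)‖ ≤ ∑ _j : Fin m, D := norm_sum_le_of_le _ fun j _ => hD j
    _ = m * D := by simp

theorem sq_sum_range_mul_sqrt_le {g : ℕ → ℝ} (hg : ∀ k, 0 ≤ g k) {η : ℝ} (hη : 0 < η)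
    (T k : ℕ) (C : ℝ) :
    (C * ∑ l ∈ range T, 2 * √(g (k + l) / η)) ^ 2 ≤
      (4 * C ^ 2 * T / η) * ∑ l ∈ range T, g (k + l) := by
  have hcs := sq_sum_le_card_mul_sum_sq (s := range T) (f := fun l => 2 * √(g (k + l) / η))
  have hsq : ∀ l, (2 * √(g (k + l) / η)) ^ 2 = 4 / η * g (k + l) := by
    intro l
    rw [mul_pow, Real.sq_sqrt (div_nonneg (hg _) hη.le)]
    ring
  simp_rw [hsq, ← Finset.mul_sum, Finset.card_range] at hcs
  rw [mul_pow, ← Finset.mul_sum]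
  calc C ^ 2 * (2 * ∑ l ∈ range T, √(g (k + l) / η)) ^ 2
      ≤ C ^ 2 * (T * (4 / η * ∑ l ∈ range T, g (k + l))) := by gcongr
    _ = _ := by ring

theorem stmt13
    (n m : ℕ) (hm : 2 ≤ m)
    (X : Fin m → Set (EuclideanSpace ℝ (Fin n)))
    (hXne : ∀ i, (X i).Nonempty)
    (hXcpt : ∀ i, IsCompact (X i))
    (hXconv : ∀ i, Convex ℝ (X i))
    (f : Fin m → EuclideanSpace ℝ (Fin n) → ℝ)
    (hfconv : ∀ i, ConvexOn ℝ Set.univ (f i))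
    (xbar : EuclideanSpace ℝ (Fin n)) (ρ : ℝ) (hρ : 0 < ρ)
    (hball : Metric.ball xbar ρ ⊆ ⋂ i, X i)
    (Xstar : Set (EuclideanSpace ℝ (Fin n)))
    (hXstar : Xstar = {p | p ∈ ⋂ i, X i ∧ ∀ y ∈ ⋂ i, X i, ∑ i, f i p ≤ ∑ i, f i y})
    (hXstar_ne : Xstar.Nonempty)
    (a : ℕ → Fin m → Fin m → ℝ)
    (ha_nonneg : ∀ k i j, 0 ≤ a k i j)
    (ha_row : ∀ k i, ∑ j, a k i j = 1)
    (ha_col : ∀ k j, ∑ i, a k i j = 1)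
    (η : ℝ) (hη : η ∈ Set.Ioo (0:ℝ) 1)
    (ha_diag : ∀ k i, η ≤ a k i i)
    (ha_eta : ∀ k i j, 0 < a k i j → η ≤ a k i j)
    (hconn : ∀ u v : Fin m,
      Relation.ReflTransGen (fun p1 p2 => {k : ℕ | 0 < a k p2 p1}.Infinite) u v)
    (T : ℕ) (hT : 1 ≤ T)
    (hTcomm : ∀ j i : Fin m, {k : ℕ | 0 < a k i j}.Infinite →
      ∀ k : ℕ, ∃ l, k ≤ l ∧ l < k + T ∧ 0 < a l i j)
    (c : ℕ → ℝ) (hc_pos : ∀ k, 0 < c k) (hc_anti : Antitone c)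
    (hc_div : Tendsto (fun N => ∑ k ∈ Finset.range N, c k) atTop atTop)
    (hc_sq : Summable (fun k => (c k)^2))
    (x : Fin m → ℕ → EuclideanSpace ℝ (Fin n))
    (hx0 : ∀ i, x i 0 ∈ X i)
    (z : Fin m → ℕ → EuclideanSpace ℝ (Fin n))
    (hz : ∀ i k, z i k = ∑ j, a k i j • x j k)
    (hupd_mem : ∀ i k, x i (k+1) ∈ X i)
    (hupd_min : ∀ i k, ∀ y ∈ X i,
      f i (x i (k+1)) + (1/(2 * c k)) * ‖z i k - x i (k+1)‖^2
        ≤ f i y + (1/(2 * c k)) * ‖z i k - y‖^2)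
    (hupd_uniq : ∀ i k, ∀ y ∈ X i,
      f i y + (1/(2 * c k)) * ‖z i k - y‖^2
        = f i (x i (k+1)) + (1/(2 * c k)) * ‖z i k - x i (k+1)‖^2 → y = x i (k+1))
    (v : ℕ → EuclideanSpace ℝ (Fin n))
    (hv : ∀ k, v k = (m : ℝ)⁻¹ • ∑ i, x i k)
    (eps : ℕ → ℝ)
    (heps : ∀ k, eps k = ∑ i, Metric.infDist (v k) (X i))
    (vbar : ℕ → EuclideanSpace ℝ (Fin n))
    (hvbar : ∀ k, vbar k = (eps k / (eps k + ρ)) • xbar + (ρ / (eps k + ρ)) • v k)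
    :
    ∀ xstar ∈ Xstar,
      Filter.liminf (fun k : ℕ => ∑ i, (f i (vbar (k + 1)) - f i xstar)) atTop = 0 := by
  have hmpos : 0 < m := by omega
  have : NeZero m := ⟨hmpos.ne'⟩
  have hη0 : 0 < η := hη.1
  intro xstar hxstar
  rw [hXstar] at hxstar
  obtain ⟨hxs, hopt⟩ := hxstar
  have hxs' : ∀ i, xstar ∈ X i := Set.mem_iInter.1 hxs
  have hballX : ∀ i, ball xbar ρ ⊆ X i := fun i => hball.trans (Set.iInter_subset _ i)
  have hxX : ∀ i k, x i k ∈ X i := fun i k => by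
    cases k with
    | zero => exact hx0 i
    | succ k => exact hupd_mem i k
  obtain ⟨R, hR⟩ : ∃ R, ∀ i, X i ⊆ closedBall 0 R := by
    obtain ⟨R, hR⟩ := (isCompact_iUnion hXcpt).isBounded.subset_closedBall 0
    exact ⟨R, fun i => (Set.subset_iUnion X i).trans hR⟩
  have hdiam : ∀ p ∈ closedBall (0 : EuclideanSpace ℝ (Fin n)) R, ∀ q ∈ closedBall 0 R,
      ‖p - q‖ ≤ 2 * R := by
    intro p hp q hq
    rw [mem_closedBall_zero_iff] at hp hq
    linarith [norm_sub_le p q]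
  have hxR : ∀ i k, x i k ∈ closedBall (0 : EuclideanSpace ℝ (Fin n)) R := fun i k =>
    hR i (hxX i k)
  have hzR : ∀ i k, z i k ∈ closedBall (0 : EuclideanSpace ℝ (Fin n)) R := fun i k => by
    rw [hz]
    exact (convex_closedBall _ _).sum_mem (fun j _ => ha_nonneg k i j) (ha_row k i)
      fun j _ => hxR j k
  have hvR : ∀ k, v k ∈ closedBall (0 : EuclideanSpace ℝ (Fin n)) R := fun k => by
    rw [hv, mem_closedBall, dist_eq_norm]
    exact norm_sub_mean_le hmpos fun j => by simpa using hxR j k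
  have hxbarR : xbar ∈ closedBall (0 : EuclideanSpace ℝ (Fin n)) R :=
    hR 0 (hballX 0 (mem_ball_self hρ))
  have heps0 : ∀ k, 0 ≤ eps k := fun k => by
    rw [heps]
    exact Finset.sum_nonneg fun i _ => infDist_nonneg
  have hvbarX : ∀ k i, vbar k ∈ X i := fun k i => by
    rw [hvbar]
    refine combo_center_mem (hXconv i) (hXcpt i) hρ (hballX i) ?_
    rw [heps]
    exact Finset.single_le_sum (f := fun i => infDist (v k) (X i))
      (fun _ _ => infDist_nonneg) (Finset.mem_univ i)
  choose L hL0 hL using fun i => (hfconv i).exists_abs_sub_le_of_isCompact (hXcpt i)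
  -- the gain of one iteration: proximal displacement plus averaging variance
  set g : ℕ → ℝ := fun k =>
    ∑ i, (‖x i (k + 1) - z i k‖ ^ 2 + ∑ j, a k i j * ‖x j k - z i k‖ ^ 2) with hgdef
  have hvar0 : ∀ k i, 0 ≤ ∑ j, a k i j * ‖x j k - z i k‖ ^ 2 := fun k i =>
    Finset.sum_nonneg fun j _ => mul_nonneg (ha_nonneg k i j) (sq_nonneg _)
  have hg0 : ∀ k, 0 ≤ g k := fun k => Finset.sum_nonneg fun i _ =>
    add_nonneg (sq_nonneg _) (hvar0 k i)
  have hgG : ∀ k, g k ≤ m * (2 * (2 * R) ^ 2) := fun k => by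
    calc g k ≤ ∑ _i : Fin m, 2 * (2 * R) ^ 2 := by
          refine Finset.sum_le_sum fun i _ => ?_
          have h1 : ‖x i (k + 1) - z i k‖ ^ 2 ≤ (2 * R) ^ 2 := by
            gcongr
            exact hdiam _ (hxR _ _) _ (hzR _ _)
          have h2 : ∑ j, a k i j * ‖x j k - z i k‖ ^ 2 ≤ ∑ j, a k i j * (2 * R) ^ 2 := by
            refine Finset.sum_le_sum fun j _ => mul_le_mul_of_nonneg_left ?_ (ha_nonneg k i j)
            gcongr
            exact hdiam _ (hxR _ _) _ (hzR _ _)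
          rw [← Finset.sum_mul, ha_row, one_mul] at h2
          linarith
      _ = _ := by simp
  have hgi : ∀ k i, ‖x i (k + 1) - z i k‖ ^ 2 + ∑ j, a k i j * ‖x j k - z i k‖ ^ 2 ≤ g k :=
    fun k i => Finset.single_le_sum
      (f := fun i => ‖x i (k + 1) - z i k‖ ^ 2 + ∑ j, a k i j * ‖x j k - z i k‖ ^ 2)
      (fun i _ => add_nonneg (sq_nonneg _) (hvar0 k i)) (Finset.mem_univ i)
  have hnear : ∀ k i j, η ≤ a k i j → ‖x j k - z i k‖ ≤ √(g k / η) := by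
    intro k i j hij
    refine Real.le_sqrt_of_sq_le ?_
    rw [le_div_iff₀ hη0]
    have h1 : a k i j * ‖x j k - z i k‖ ^ 2 ≤ ∑ j, a k i j * ‖x j k - z i k‖ ^ 2 :=
      Finset.single_le_sum (f := fun j => a k i j * ‖x j k - z i k‖ ^ 2)
        (fun j _ => mul_nonneg (ha_nonneg k i j) (sq_nonneg _)) (Finset.mem_univ j)
    have h2 : η * ‖x j k - z i k‖ ^ 2 ≤ a k i j * ‖x j k - z i k‖ ^ 2 := by gcongr
    linarith [hgi k i, sq_nonneg ‖x i (k + 1) - z i k‖]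
  have hprox : ∀ k i, ‖x i (k + 1) - z i k‖ ≤ √(g k / η) := by
    intro k i
    refine Real.le_sqrt_of_sq_le ?_
    rw [le_div_iff₀ hη0]
    have : ‖x i (k + 1) - z i k‖ ^ 2 * η ≤ ‖x i (k + 1) - z i k‖ ^ 2 :=
      mul_le_of_le_one_right (sq_nonneg _) hη.2.le
    linarith [hgi k i, hvar0 k i]
  obtain ⟨C, hC⟩ := exists_norm_sub_le_sum_window x (fun k => 2 * √(g k / η))
    (fun k => by positivity) T _ hconn
    (fun i k => by
      have := norm_sub_le_norm_sub_add_norm_sub (x i (k + 1)) (z i k) (x i k)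
      rw [norm_sub_rev (z i k)] at this
      linarith [hprox k i, hnear k i i (ha_diag k i)])
    (fun j i hji k => by
      obtain ⟨l, hkl, hlT, hl⟩ := hTcomm j i hji k
      refine ⟨l, hkl, hlT, ?_⟩
      have := norm_sub_le_norm_sub_add_norm_sub (x j l) (z i l) (x i l)
      rw [norm_sub_rev (z i l)] at this
      linarith [hnear l i j (ha_eta l i j hl), hnear l i i (ha_diag l i)])
  set H : ℕ → ℝ := fun k => ∑ l ∈ range T, 2 * √(g (k + l) / η)
  have hvx : ∀ k i, ‖v k - x i k‖ ≤ C * H k := fun k i => by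
    rw [hv]
    exact norm_sub_mean_le hmpos fun j => hC j i k
  have heps_le : ∀ k, eps k ≤ m * (C * H k) := fun k => by
    rw [heps]
    calc ∑ i, infDist (v k) (X i) ≤ ∑ _i : Fin m, C * H k :=
          Finset.sum_le_sum fun i _ => (infDist_le_dist_of_mem (hxX i k)).trans
            (by rw [dist_eq_norm]; exact hvx k i)
      _ = _ := by simp
  set D : ℝ := (m / ρ * (2 * R) + 1) * C with hDdef
  have hvbarx : ∀ k i, ‖vbar k - x i k‖ ≤ D * H k := fun k i => by
    have h1 : ‖vbar k - v k‖ ≤ m * (C * H k) / ρ * (2 * R) := by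
      rw [hvbar]
      refine (dist_combo_center_le hρ (heps0 k)).trans ?_
      gcongr
      · exact div_nonneg ((heps0 k).trans (heps_le k)) hρ.le
      · exact heps_le k
      · exact hdiam _ hxbarR _ (hvR k)
    calc ‖vbar k - x i k‖ ≤ ‖vbar k - v k‖ + ‖v k - x i k‖ :=
          norm_sub_le_norm_sub_add_norm_sub _ _ _
      _ ≤ m * (C * H k) / ρ * (2 * R) + C * H k := add_le_add h1 (hvx k i)
      _ = D * H k := by rw [hDdef]; ring
  set M : ℝ := (∑ i, L i) * D
  have hfgap : ∀ k, ∑ i, (f i (vbar k) - f i xstar) ≤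
      ∑ i, (f i (x i k) - f i xstar) + M * H k := fun k => by
    have : ∀ i, f i (vbar k) - f i xstar ≤ (f i (x i k) - f i xstar) + L i * (D * H k) := by
      intro i
      have h1 := (le_abs_self _).trans (hL i _ (hvbarX k i) _ (hxX i k))
      have h2 : L i * ‖vbar k - x i k‖ ≤ L i * (D * H k) :=
        mul_le_mul_of_nonneg_left (hvbarx k i) (hL0 i)
      linarith
    refine (Finset.sum_le_sum fun i _ => this i).trans_eq ?_
    rw [Finset.sum_add_distrib, ← Finset.sum_mul, ← mul_assoc]
  obtain ⟨K, hK⟩ := exists_sum_mul_le_of_descent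
    (V := fun k => ∑ i, ‖x i k - xstar‖ ^ 2) (c := c) (g := g)
    (u := fun k => ∑ i, (f i (vbar (k + 1)) - f i xstar)) (w := fun k => M * H (k + 1))
    (B := 4 * M ^ 2 * T / η) (T := T)
    (fun k => Finset.sum_nonneg fun i _ => sq_nonneg _) hg0 hgG (by positivity) hc_sq
    (fun k => by
      have hdesc := sum_prox_descent hXconv hfconv (ha_row k) (ha_col k) (hc_pos k)
        (fun i => hz i k) (fun i => hupd_mem i k) (fun i => hupd_min i k) hxs'
      have hgap := mul_le_mul_of_nonneg_left (hfgap (k + 1))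
        (mul_nonneg zero_le_two (hc_pos k).le)
      simp only [hgdef]
      linarith)
    (fun k => sq_sum_range_mul_sqrt_le hg0 hη0 T (k + 1) M)
  refine liminf_eq_zero_of_sum_mul_le hc_pos hc_div (fun k => ?_) hK
  rw [Finset.sum_sub_distrib, sub_nonneg]
  exact hopt _ (Set.mem_iInter.2 (hvbarX (k + 1)))
end

section
/- Under the full assumptions and Algorithm 1, there exists a minimizer x* ∈ X* such that simultaneously lim_{k→∞} ‖x_i(k) − x*‖ = 0 for every i = 1,…,m, lim_{k→∞} ‖v(k) − x*‖ = 0, and lim_{k→∞} ‖v̄(k) − x*‖ = 0. -/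
open Filter Finset Metric
open scoped Topology BigOperators

/-- The transition weights of a time-varying linear iteration with weights `a`,
from time `s` to time `s + r`. -/
noncomputable def transitionWeights {ι : Type*} [Fintype ι] [DecidableEq ι] (a : ℕ → ι → ι → ℝ)
    (s : ℕ) : ℕ → ι → ι → ℝ
  | 0 => fun i j => if i = j then 1 else 0
  | r + 1 => fun i j => ∑ l, a (s + r) i l * transitionWeights a s r l j

lemma sum_norm_sum_smul_le {ι E : Type*} [Fintype ι] [SeminormedAddCommGroup E] [NormedSpace ℝ E]
    {w : ι → ι → ℝ} (hw : ∀ i j, 0 ≤ w i j) {C : ℝ}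
    (hC : ∀ j, ∑ i, w i j = C) (y : ι → E) :
    ∑ i, ‖∑ j, w i j • y j‖ ≤ C * ∑ j, ‖y j‖ := by
  calc ∑ i, ‖∑ j, w i j • y j‖ ≤ ∑ i, ∑ j, w i j * ‖y j‖ := by
        refine Finset.sum_le_sum fun i _ => (norm_sum_le _ _).trans_eq ?_
        exact Finset.sum_congr rfl fun j _ => by
          rw [norm_smul, Real.norm_of_nonneg (hw i j)]
    _ = C * ∑ j, ‖y j‖ := by
        rw [Finset.sum_comm, Finset.mul_sum]
        simp_rw [← Finset.sum_mul, hC]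

section Consensus

variable {ι : Type*} [Fintype ι] [DecidableEq ι] {a : ℕ → ι → ι → ℝ}

lemma transitionWeights_nonneg (ha : ∀ k i j, 0 ≤ a k i j) (s r : ℕ) (i j : ι) :
    0 ≤ transitionWeights a s r i j := by
  induction r generalizing i with
  | zero => simp only [transitionWeights]; split_ifs <;> norm_num
  | succ r ih => exact Finset.sum_nonneg fun l _ => mul_nonneg (ha _ _ _) (ih l)

lemma sum_transitionWeights_col (hcol : ∀ k j, ∑ i, a k i j = 1) (s r : ℕ) (j : ι) :
    ∑ i, transitionWeights a s r i j = 1 := by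
  induction r with
  | zero => simp [transitionWeights]
  | succ r ih =>
    simp only [transitionWeights]
    rw [Finset.sum_comm]
    simp_rw [← Finset.sum_mul, hcol, one_mul]
    exact ih

lemma pow_succ_le_transitionWeights (ha : ∀ k i j, 0 ≤ a k i j) {η : ℝ} (hη : 0 < η) {s r : ℕ}
    {i b j : ι} (hr : η ^ r ≤ transitionWeights a s r b j) (hib : η ≤ a (s + r) i b) :
    η ^ (r + 1) ≤ transitionWeights a s (r + 1) i j := by
  have hib0 := hη.le.trans hib
  calc η ^ (r + 1) = η * η ^ r := pow_succ' _ _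
    _ ≤ a (s + r) i b * transitionWeights a s r b j := by gcongr
    _ ≤ ∑ l, a (s + r) i l * transitionWeights a s r l j :=
      Finset.single_le_sum (f := fun l => a (s + r) i l * transitionWeights a s r l j)
        (fun l _ => mul_nonneg (ha _ _ _) (transitionWeights_nonneg ha _ _ _ _))
        (Finset.mem_univ b)

lemma pow_le_transitionWeights_of_le (ha : ∀ k i j, 0 ≤ a k i j) {η : ℝ} (hη : 0 < η)
    (hdiag : ∀ k i, η ≤ a k i i) {s r r' : ℕ} {i j : ι}
    (hr : η ^ r ≤ transitionWeights a s r i j) (hrr : r ≤ r') :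
    η ^ r' ≤ transitionWeights a s r' i j := by
  induction r', hrr using Nat.le_induction with
  | base => exact hr
  | succ r' _ ih => exact pow_succ_le_transitionWeights ha hη ih (hdiag _ _)

lemma exists_pow_le_transitionWeights (ha : ∀ k i j, 0 ≤ a k i j) {η : ℝ} (hη : 0 < η)
    (hdiag : ∀ k i, η ≤ a k i i) (hpos : ∀ k i j, 0 < a k i j → η ≤ a k i j)
    (hconn : ∀ u v : ι, Relation.ReflTransGen (fun p q => {k : ℕ | 0 < a k q p}.Infinite) u v)
    (T : ℕ) (hT : ∀ j i : ι, {k : ℕ | 0 < a k i j}.Infinite →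
      ∀ k : ℕ, ∃ l, k ≤ l ∧ l < k + T ∧ 0 < a l i j) :
    ∃ B, ∀ s i j, η ^ B ≤ transitionWeights a s B i j := by
  have key : ∀ p : ι × ι, ∃ r, ∀ s, η ^ r ≤ transitionWeights a s r p.1 p.2 := by
    rintro ⟨i, j⟩
    induction hconn j i with
    | refl => exact ⟨0, fun s => by simp [transitionWeights]⟩
    | @tail b i _ hbi ih =>
      obtain ⟨r, hr⟩ := ih
      refine ⟨r + T, fun s => ?_⟩
      obtain ⟨l, hl, hlT, hal⟩ := hT b i hbi (s + r)
      obtain ⟨t, rfl⟩ := Nat.exists_eq_add_of_le (show s ≤ l by omega)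
      have h1 := pow_le_transitionWeights_of_le ha hη hdiag (hr s) (show r ≤ t by omega)
      exact pow_le_transitionWeights_of_le ha hη hdiag
        (pow_succ_le_transitionWeights ha hη h1 (hpos _ _ _ hal)) (by omega)
  choose r hr using key
  exact ⟨Finset.univ.sup r, fun s i j => pow_le_transitionWeights_of_le ha hη hdiag (hr (i, j) s)
    (Finset.le_sup (Finset.mem_univ _))⟩

variable {E : Type*} [SeminormedAddCommGroup E] [NormedSpace ℝ E]

lemma sum_norm_sub_transitionWeights_le (ha : ∀ k i j, 0 ≤ a k i j)
    (hcol : ∀ k j, ∑ i, a k i j = 1) {y d : ℕ → ι → E}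
    (hy : ∀ k i, y (k + 1) i = ∑ j, a k i j • y k j + d k i) (s r : ℕ) :
    ∑ i, ‖y (s + r) i - ∑ j, transitionWeights a s r i j • y s j‖ ≤
      ∑ t ∈ Finset.range r, ∑ i, ‖d (s + t) i‖ := by
  induction r with
  | zero => simp [transitionWeights, ite_smul]
  | succ r ih =>
    rw [Finset.sum_range_succ]
    have hstep : ∀ i, y (s + (r + 1)) i - ∑ j, transitionWeights a s (r + 1) i j • y s j =
        ∑ l, a (s + r) i l • (y (s + r) l - ∑ j, transitionWeights a s r l j • y s j)
          + d (s + r) i := by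
      intro i
      rw [← add_assoc, hy]
      simp only [transitionWeights, smul_sub, Finset.sum_sub_distrib, Finset.smul_sum,
        Finset.sum_smul, smul_smul]
      rw [Finset.sum_comm]
      abel
    calc _ ≤ ∑ i, (‖∑ l, a (s + r) i l •
            (y (s + r) l - ∑ j, transitionWeights a s r l j • y s j)‖ + ‖d (s + r) i‖) := by
          refine Finset.sum_le_sum fun i _ => ?_
          rw [hstep]
          exact norm_add_le _ _
      _ ≤ _ := by
          rw [Finset.sum_add_distrib]
          gcongr
          refine (sum_norm_sum_smul_le (ha _) (hcol _) _).trans ?_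
          rw [one_mul]
          exact ih

lemma sum_norm_add_le_of_le_transitionWeights (ha : ∀ k i j, 0 ≤ a k i j)
    (hcol : ∀ k j, ∑ i, a k i j = 1) {y d : ℕ → ι → E}
    (hy : ∀ k i, y (k + 1) i = ∑ j, a k i j • y k j + d k i) {s : ℕ} (h0 : ∑ i, y s i = 0)
    {r : ℕ} {β : ℝ} (hβ : ∀ i j, β ≤ transitionWeights a s r i j) :
    ∑ i, ‖y (s + r) i‖ ≤ (1 - Fintype.card ι * β) * ∑ i, ‖y s i‖ +
      ∑ t ∈ Finset.range r, ∑ i, ‖d (s + t) i‖ := by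
  have hrw : ∀ i, ∑ j, transitionWeights a s r i j • y s j =
      ∑ j, (transitionWeights a s r i j - β) • y s j := by
    intro i
    simp only [sub_smul, Finset.sum_sub_distrib]
    rw [← Finset.smul_sum, h0, smul_zero, sub_zero]
  have h1 : ∑ i, ‖∑ j, transitionWeights a s r i j • y s j‖ ≤
      (1 - Fintype.card ι * β) * ∑ i, ‖y s i‖ := by
    simp_rw [hrw]
    refine sum_norm_sum_smul_le (fun i j => sub_nonneg.2 (hβ i j)) (fun j => ?_) _
    rw [Finset.sum_sub_distrib, sum_transitionWeights_col hcol]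
    simp
  calc ∑ i, ‖y (s + r) i‖ ≤ ∑ i, (‖∑ j, transitionWeights a s r i j • y s j‖ +
        ‖y (s + r) i - ∑ j, transitionWeights a s r i j • y s j‖) :=
        Finset.sum_le_sum fun i _ => norm_le_norm_add_norm_sub' _ _
    _ ≤ _ := by
        rw [Finset.sum_add_distrib]
        exact add_le_add h1 (sum_norm_sub_transitionWeights_le ha hcol hy s r)

end Consensus

/-- A nonnegative sequence contracting over windows of length `B`, up to perturbations `e`, is
square summable up to the squares of `e`. -/
lemma exists_sum_sq_le_of_window_contraction {S e : ℕ → ℝ} (hS : ∀ k, 0 ≤ S k) {q : ℝ}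
    (hq0 : 0 ≤ q) (hq1 : q < 1) {B : ℕ}
    (h : ∀ k, S (k + B) ≤ q * S k + ∑ t ∈ Finset.range B, e (k + t)) :
    ∃ C, 0 ≤ C ∧ ∀ N, ∑ k ∈ Finset.range N, S k ^ 2 ≤ C + C * ∑ k ∈ Finset.range N, e k ^ 2 := by
  have hp : 0 < 1 - q := sub_pos.2 hq1
  set A := ∑ k ∈ Finset.range B, S k ^ 2 with hA
  have hA0 : 0 ≤ A := Finset.sum_nonneg fun _ _ => sq_nonneg _
  have hsq : ∀ k, S (k + B) ^ 2 ≤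
      q * S k ^ 2 + B / (1 - q) * ∑ t ∈ Finset.range B, e (k + t) ^ 2 := by
    intro k
    set w := ∑ t ∈ Finset.range B, e (k + t) with hw
    have h1 : w ^ 2 ≤ B * ∑ t ∈ Finset.range B, e (k + t) ^ 2 := by
      simpa using sq_sum_le_card_mul_sum_sq (s := Finset.range B) (f := fun t => e (k + t))
    have h2 : (q * S k + w) ^ 2 ≤ q * S k ^ 2 + w ^ 2 / (1 - q) := by
      rw [← sub_nonneg]
      have : q * S k ^ 2 + w ^ 2 / (1 - q) - (q * S k + w) ^ 2 =
          q * (1 - q) * (S k - w / (1 - q)) ^ 2 := by field_simp; ring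
      rw [this]; positivity
    calc S (k + B) ^ 2 ≤ (q * S k + w) ^ 2 := pow_le_pow_left₀ (hS _) (h k) 2
      _ ≤ q * S k ^ 2 + w ^ 2 / (1 - q) := h2
      _ ≤ q * S k ^ 2 + (B * ∑ t ∈ Finset.range B, e (k + t) ^ 2) / (1 - q) := by gcongr
      _ = _ := by ring
  refine ⟨A / (1 - q) + B / (1 - q) * B / (1 - q), by positivity, fun N => ?_⟩
  have hE0 : 0 ≤ ∑ k ∈ Finset.range N, e k ^ 2 := Finset.sum_nonneg fun _ _ => sq_nonneg _
  set F := ∑ k ∈ Finset.range N, e k ^ 2 with hF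
  have hAq : A ≤ A / (1 - q) := le_div_self hA0 hp (by linarith)
  have hmain : ∑ k ∈ Finset.range N, S k ^ 2 ≤ A / (1 - q) + B / (1 - q) * B / (1 - q) * F := by
    rcases le_total N B with hN | hN
    · calc ∑ k ∈ Finset.range N, S k ^ 2 ≤ A :=
            Finset.sum_le_sum_of_subset_of_nonneg (Finset.range_mono hN) fun _ _ _ => sq_nonneg _
        _ ≤ _ := by
          have : 0 ≤ B / (1 - q) * B / (1 - q) * F := by positivity
          linarith
    · obtain ⟨M, rfl⟩ := Nat.exists_eq_add_of_le hN
      have h1 : ∑ k ∈ Finset.range (B + M), S k ^ 2 =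
          A + ∑ k ∈ Finset.range M, S (k + B) ^ 2 := by
        rw [Finset.sum_range_add]
        simp_rw [add_comm B]
        rfl
      have h2 : ∑ k ∈ Finset.range M, S (k + B) ^ 2 ≤ q * ∑ k ∈ Finset.range M, S k ^ 2 +
          B / (1 - q) * ∑ k ∈ Finset.range M, ∑ t ∈ Finset.range B, e (k + t) ^ 2 := by
        rw [Finset.mul_sum, Finset.mul_sum, ← Finset.sum_add_distrib]
        exact Finset.sum_le_sum fun k _ => hsq k
      have h3 : ∑ k ∈ Finset.range M, ∑ t ∈ Finset.range B, e (k + t) ^ 2 ≤ B * F := by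
        rw [Finset.sum_comm]
        calc ∑ t ∈ Finset.range B, ∑ k ∈ Finset.range M, e (k + t) ^ 2
            ≤ ∑ t ∈ Finset.range B, F := by
              refine Finset.sum_le_sum fun t ht => ?_
              have hsplit := Finset.sum_range_add (fun k => e k ^ 2) t M
              simp_rw [add_comm t] at hsplit
              have ht' : 0 ≤ ∑ k ∈ Finset.range t, e k ^ 2 :=
                Finset.sum_nonneg fun _ _ => sq_nonneg _
              have : ∑ k ∈ Finset.range (M + t), e k ^ 2 ≤ F :=
                Finset.sum_le_sum_of_subset_of_nonneg
                  (Finset.range_mono (by have := Finset.mem_range.1 ht; omega))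
                  fun _ _ _ => sq_nonneg _
              linarith
          _ = B * F := by simp
      have h4 : ∑ k ∈ Finset.range M, S k ^ 2 ≤ ∑ k ∈ Finset.range (B + M), S k ^ 2 :=
        Finset.sum_le_sum_of_subset_of_nonneg (Finset.range_mono (by omega))
          fun _ _ _ => sq_nonneg _
      have h5 : B / (1 - q) * ∑ k ∈ Finset.range M, ∑ t ∈ Finset.range B, e (k + t) ^ 2 ≤
          B / (1 - q) * (B * F) := by gcongr
      have h6 : q * ∑ k ∈ Finset.range M, S k ^ 2 ≤ q * ∑ k ∈ Finset.range (B + M), S k ^ 2 := by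
        gcongr
      have h7 : A / (1 - q) + B / (1 - q) * B / (1 - q) * F =
          (A + B / (1 - q) * (B * F)) / (1 - q) := by
        ring
      rw [h7, le_div_iff₀ hp]
      linarith
  have h8 : 0 ≤ B / (1 - q) * B / (1 - q) := by positivity
  have h9 : 0 ≤ A / (1 - q) * F := by positivity
  linarith

/-- A nonnegative sequence whose increments are bounded by a summable sequence and which is
frequently small tends to zero. -/
lemma tendsto_zero_of_frequently_lt {D w : ℕ → ℝ} (hD : ∀ k, 0 ≤ D k) (hw0 : ∀ k, 0 ≤ w k)
    (hw : Summable w) (hDw : ∀ k, D (k + 1) ≤ D k + w k)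
    (hfreq : ∀ δ > 0, ∃ᶠ k in atTop, D k < δ) : Tendsto D atTop (𝓝 0) := by
  rw [tendsto_order]
  refine ⟨fun b hb => Eventually.of_forall fun k => hb.trans_le (hD k), fun δ hδ => ?_⟩
  have htail : ∀ᶠ k in atTop, ∑' j, w (j + k) < δ / 2 :=
    (tendsto_sum_nat_add w).eventually_lt_const (by linarith)
  obtain ⟨k, hk, hkt⟩ := ((hfreq (δ / 2) (by linarith)).and_eventually htail).exists
  have hbound : ∀ t, D (k + t) ≤ D k + ∑ j ∈ Finset.range t, w (j + k) := by
    intro t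
    induction t with
    | zero => simp
    | succ t ih =>
      rw [Finset.sum_range_succ]
      have := hDw (k + t)
      rw [add_comm t k, ← add_assoc]
      linarith
  filter_upwards [eventually_ge_atTop k] with l hl
  obtain ⟨t, rfl⟩ := Nat.exists_eq_add_of_le hl
  have h1 : ∑ j ∈ Finset.range t, w (j + k) ≤ ∑' j, w (j + k) :=
    ((summable_nat_add_iff k).2 hw).sum_le_tsum _ fun _ _ => hw0 _
  linarith [hbound t]

lemma frequently_lt_of_sum_mul_le {c g : ℕ → ℝ} (hc : ∀ k, 0 ≤ c k)
    (hdiv : Tendsto (fun N => ∑ k ∈ Finset.range N, c k) atTop atTop) (hg : ∀ k, 0 ≤ g k) {A : ℝ}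
    (hA : ∀ N, ∑ k ∈ Finset.range N, c k * g k ≤ A) {δ : ℝ} (hδ : 0 < δ) :
    ∃ᶠ k in atTop, g k < δ := by
  intro hev
  simp only [not_lt] at hev
  obtain ⟨K, hK⟩ := eventually_atTop.1 hev
  obtain ⟨N, hN1, hN2⟩ := ((hdiv.eventually_gt_atTop (A / δ + ∑ k ∈ Finset.range K, c k)).and
    (eventually_ge_atTop K)).exists
  have h1 : ∀ N, δ * (∑ k ∈ Finset.range N, c k - ∑ k ∈ Finset.range K, c k) ≤
      ∑ k ∈ Finset.range N, c k * g k ∨ N < K := by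
    intro N
    rcases lt_or_ge N K with h | h
    · exact Or.inr h
    · left
      induction N, h using Nat.le_induction with
      | base =>
        rw [sub_self, mul_zero]
        exact Finset.sum_nonneg fun k _ => mul_nonneg (hc k) (hg k)
      | succ N hN ih =>
        rw [Finset.sum_range_succ, Finset.sum_range_succ]
        nlinarith [mul_le_mul_of_nonneg_left (hK N hN) (hc N)]
  have h2 := (h1 N).resolve_right (not_lt.2 hN2)
  have h3 : A / δ < ∑ k ∈ Finset.range N, c k - ∑ k ∈ Finset.range K, c k := by linarith
  rw [div_lt_iff₀ hδ] at h3
  linarith [hA N]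

/-- The three-point inequality for the proximal step of a convex function over a convex set. -/
lemma ConvexOn.two_mul_sub_add_norm_sq_le_of_prox {E : Type*} [NormedAddCommGroup E]
    [InnerProductSpace ℝ E] {X : Set E} {f : E → ℝ} (hf : ConvexOn ℝ X f)
    {c : ℝ} (hc : 0 < c) {x z : E} (hx : x ∈ X)
    (hmin : ∀ y ∈ X, f x + (1 / (2 * c)) * ‖z - x‖ ^ 2 ≤ f y + (1 / (2 * c)) * ‖z - y‖ ^ 2)
    {y : E} (hy : y ∈ X) :
    2 * c * (f x - f y) + ‖z - x‖ ^ 2 + ‖x - y‖ ^ 2 ≤ ‖z - y‖ ^ 2 := by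
  set w := y - x with hw
  set p := inner ℝ (z - x) w with hp
  have hexp : ∀ t : ℝ, ‖z - (x + t • w)‖ ^ 2 = ‖z - x‖ ^ 2 - 2 * t * p + t ^ 2 * ‖w‖ ^ 2 := by
    intro t
    rw [← sub_sub, norm_sub_sq_real, real_inner_smul_right, norm_smul, mul_pow, Real.norm_eq_abs,
      sq_abs]
    ring
  have hlin : ∀ t ∈ Set.Ioc (0 : ℝ) 1, 2 * c * (f x - f y) + 2 * p ≤ t * ‖w‖ ^ 2 := by
    rintro t ⟨ht0, ht1⟩
    have hcomb : x + t • w = (1 - t) • x + t • y := by rw [hw]; module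
    have h1 : f (x + t • w) ≤ (1 - t) * f x + t * f y := by
      rw [hcomb]
      exact hf.2 hx hy (by linarith) ht0.le (by ring)
    have h2 := hmin (x + t • w) (by
      rw [hcomb]; exact hf.1 hx hy (by linarith) ht0.le (by ring))
    rw [hexp] at h2
    have h3 : t * (f x - f y) ≤ (1 / (2 * c)) * (- 2 * t * p + t ^ 2 * ‖w‖ ^ 2) := by linarith
    rw [one_div, ← div_eq_inv_mul, le_div_iff₀ (by positivity)] at h3
    have h4 : t * (2 * c * (f x - f y) + 2 * p) ≤ t * (t * ‖w‖ ^ 2) := by linarith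
    exact le_of_mul_le_mul_left h4 ht0
  have hlim : 2 * c * (f x - f y) + 2 * p ≤ 0 := by
    have ht : Tendsto (fun t : ℝ => t * ‖w‖ ^ 2) (𝓝[>] 0) (𝓝 0) := by
      have : Tendsto (fun t : ℝ => t * ‖w‖ ^ 2) (𝓝 0) (𝓝 (0 * ‖w‖ ^ 2)) :=
        tendsto_id.mul_const _
      rw [zero_mul] at this
      exact this.mono_left nhdsWithin_le_nhds
    exact ge_of_tendsto ht (by
      filter_upwards [Ioc_mem_nhdsGT (zero_lt_one' ℝ)] with t ht' using hlin t ht')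
  have h1 := hexp 1
  rw [one_smul, show x + w = y by rw [hw]; abel] at h1
  rw [h1, norm_sub_rev x y]
  linarith

/-- If a convex set contains a closed ball around `x₀`, then moving a point `v` towards `x₀` in
proportion to its distance from the set yields a point of the set. -/
lemma Convex.smul_add_smul_mem_of_norm_sub_le {E : Type*} [NormedAddCommGroup E] [NormedSpace ℝ E]
    {X : Set E} (hX : Convex ℝ X) {x₀ : E} {ρ : ℝ} (hρ : 0 < ρ)
    (hball : Metric.closedBall x₀ ρ ⊆ X) {v p : E} (hp : p ∈ X) {ε : ℝ} (hε : ‖v - p‖ ≤ ε) :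
    (ε / (ε + ρ)) • x₀ + (ρ / (ε + ρ)) • v ∈ X := by
  have hε0 : 0 ≤ ε := (norm_nonneg _).trans hε
  rcases hε0.eq_or_lt with rfl | hε0
  · have : v = p := sub_eq_zero.1 (norm_le_zero_iff.1 hε)
    simpa [hρ.ne', this] using hp
  have hsum : ε + ρ ≠ 0 := by positivity
  have hq : x₀ + (ρ / ε) • (v - p) ∈ X := by
    apply hball
    rw [mem_closedBall_iff_norm, add_sub_cancel_left, norm_smul, Real.norm_of_nonneg (by positivity)]
    calc ρ / ε * ‖v - p‖ ≤ ρ / ε * ε := by gcongr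
      _ = ρ := by field_simp
  have hmem := hX hq hp (show 0 ≤ ε / (ε + ρ) by positivity)
    (show 0 ≤ ρ / (ε + ρ) by positivity) (by field_simp)
  convert hmem using 1
  have h1 : ε / (ε + ρ) * (ρ / ε) = ρ / (ε + ρ) := by field_simp
  rw [smul_add, smul_smul, h1]
  module

lemma norm_sum_smul_sub_sq_le {ι E : Type*} [Fintype ι] [NormedAddCommGroup E] [NormedSpace ℝ E]
    {w : ι → ℝ} (hw0 : ∀ i, 0 ≤ w i) (hw1 : ∑ i, w i = 1) (x : ι → E) (y : E) :
    ‖∑ i, w i • x i - y‖ ^ 2 ≤ ∑ i, w i * ‖x i - y‖ ^ 2 := by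
  have hconv : ConvexOn ℝ Set.univ fun u : E => ‖u‖ ^ 2 :=
    (convexOn_norm convex_univ).pow (fun _ _ => norm_nonneg _) 2
  have h := hconv.map_sum_le (t := Finset.univ) (w := w) (p := fun i => x i - y)
    (fun i _ => hw0 i) hw1 (fun _ _ => Set.mem_univ _)
  simpa [smul_sub, Finset.sum_sub_distrib, ← Finset.sum_smul, hw1] using h

/-- Combining contraction over windows with a descent inequality: the disagreement `S` is square
summable and its products with the step sizes `c` are summable. -/
lemma summable_mul_and_tendsto_zero_of_descent {S e c G D : ℕ → ℝ} (hS : ∀ k, 0 ≤ S k)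
    (hc : ∀ k, 0 ≤ c k) (hc2 : Summable fun k => c k ^ 2) {q : ℝ} (hq0 : 0 ≤ q) (hq1 : q < 1)
    {B : ℕ} (hwin : ∀ k, S (k + B) ≤ q * S k + ∑ t ∈ Finset.range B, e (k + t))
    (hone : ∀ k, S (k + 1) ≤ S k + e k) {M : ℝ} (hM : 0 ≤ M) (hG : ∀ k, e k ^ 2 ≤ M * G k)
    (hG0 : ∀ k, 0 ≤ G k) (hD : ∀ k, 0 ≤ D k) {K : ℝ} (hK : 0 ≤ K)
    (hdesc : ∀ k, D (k + 1) + G k ≤ D k + K * (c k * S (k + 1))) :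
    (Summable fun k => c k * S (k + 1)) ∧ Tendsto S atTop (𝓝 0) := by
  obtain ⟨C, hC, hCN⟩ := exists_sum_sq_le_of_window_contraction hS hq0 hq1 hwin
  set P := 2 * C + 2 with hP
  have hP0 : 0 ≤ P := by positivity
  set Q := ∑' k, c k ^ 2 with hQ
  have hQN : ∀ N, ∑ k ∈ Finset.range N, c k ^ 2 ≤ Q := fun N =>
    hc2.sum_le_tsum _ fun _ _ => sq_nonneg _
  have hS2 : ∀ N, ∑ k ∈ Finset.range N, S (k + 1) ^ 2 ≤
      P + P * M * ∑ k ∈ Finset.range N, G k := by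
    intro N
    have h1 : ∑ k ∈ Finset.range N, S (k + 1) ^ 2 ≤
        2 * ∑ k ∈ Finset.range N, S k ^ 2 + 2 * ∑ k ∈ Finset.range N, e k ^ 2 := by
      rw [Finset.mul_sum, Finset.mul_sum, ← Finset.sum_add_distrib]
      refine Finset.sum_le_sum fun k _ => ?_
      have := pow_le_pow_left₀ (hS (k + 1)) (hone k) 2
      nlinarith [sq_nonneg (S k - e k)]
    have h2 : ∑ k ∈ Finset.range N, e k ^ 2 ≤ M * ∑ k ∈ Finset.range N, G k := by
      rw [Finset.mul_sum]
      exact Finset.sum_le_sum fun k _ => hG k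
    have h3 := mul_le_mul_of_nonneg_left h2 hP0
    have h4 := hCN N
    rw [hP] at h3 ⊢
    linarith
  have hcS : ∀ δ > 0, ∀ N, ∑ k ∈ Finset.range N, c k * S (k + 1) ≤
      Q / (4 * δ) + δ * ∑ k ∈ Finset.range N, S (k + 1) ^ 2 := by
    intro δ hδ N
    have h1 : ∑ k ∈ Finset.range N, c k * S (k + 1) ≤
        (∑ k ∈ Finset.range N, c k ^ 2) / (4 * δ) + δ * ∑ k ∈ Finset.range N, S (k + 1) ^ 2 := by
      rw [Finset.sum_div, Finset.mul_sum, ← Finset.sum_add_distrib]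
      refine Finset.sum_le_sum fun k _ => ?_
      rw [← sub_nonneg]
      have : c k ^ 2 / (4 * δ) + δ * S (k + 1) ^ 2 - c k * S (k + 1) =
          (c k - 2 * δ * S (k + 1)) ^ 2 / (4 * δ) := by field_simp; ring
      rw [this]; positivity
    have h2 : (∑ k ∈ Finset.range N, c k ^ 2) / (4 * δ) ≤ Q / (4 * δ) := by
      gcongr; exact hQN N
    linarith
  have hDN : ∀ N, D N + ∑ k ∈ Finset.range N, G k ≤
      D 0 + K * ∑ k ∈ Finset.range N, c k * S (k + 1) := by
    intro N
    induction N with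
    | zero => simp
    | succ N ih =>
      rw [Finset.sum_range_succ, Finset.sum_range_succ, mul_add]
      linarith [hdesc N]
  obtain ⟨W, hW⟩ : ∃ W, ∀ N, ∑ k ∈ Finset.range N, G k ≤ W := by
    set δ := 1 / (2 * (K * (P * M) + 1)) with hδ
    have hδ0 : 0 < δ := by positivity
    have hKδ : K * (P * M) * δ ≤ 1 / 2 := by
      rw [hδ, mul_one_div, div_le_iff₀ (by positivity)]
      linarith
    refine ⟨2 * (D 0 + K * (Q / (4 * δ)) + K * (δ * P)), fun N => ?_⟩
    have hGN : 0 ≤ ∑ k ∈ Finset.range N, G k := Finset.sum_nonneg fun k _ => hG0 k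
    have h1 := mul_le_mul_of_nonneg_left (hcS δ hδ0 N) hK
    have h2 := mul_le_mul_of_nonneg_left (mul_le_mul_of_nonneg_left (hS2 N) hδ0.le) hK
    have h3 := mul_le_mul_of_nonneg_right hKδ hGN
    linarith [hDN N, hD N]
  have hS2W : ∀ N, ∑ k ∈ Finset.range N, S (k + 1) ^ 2 ≤ P + P * M * W := fun N => by
    have := mul_le_mul_of_nonneg_left (hW N) (mul_nonneg hP0 hM)
    linarith [hS2 N]
  refine ⟨summable_of_sum_range_le (c := Q / (4 * 1) + 1 * (P + P * M * W))
    (fun k => mul_nonneg (hc k) (hS _)) fun N => ?_, ?_⟩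
  · linarith [hcS 1 one_pos N, hS2W N]
  · have hsum : Summable fun k => S (k + 1) ^ 2 :=
      summable_of_sum_range_le (fun k => sq_nonneg _) hS2W
    rw [← tendsto_add_atTop_iff_nat 1]
    have := hsum.tendsto_atTop_zero.sqrt
    simpa [Real.sqrt_sq (hS _)] using this

theorem stmt14
    (n m : ℕ) (hm : 2 ≤ m)
    (X : Fin m → Set (EuclideanSpace ℝ (Fin n)))
    (hXne : ∀ i, (X i).Nonempty)
    (hXcpt : ∀ i, IsCompact (X i))
    (hXconv : ∀ i, Convex ℝ (X i))
    (f : Fin m → EuclideanSpace ℝ (Fin n) → ℝ)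
    (hfconv : ∀ i, ConvexOn ℝ Set.univ (f i))
    (xbar : EuclideanSpace ℝ (Fin n)) (ρ : ℝ) (hρ : 0 < ρ)
    (hball : Metric.ball xbar ρ ⊆ ⋂ i, X i)
    (Xstar : Set (EuclideanSpace ℝ (Fin n)))
    (hXstar : Xstar = {p | p ∈ ⋂ i, X i ∧ ∀ y ∈ ⋂ i, X i, ∑ i, f i p ≤ ∑ i, f i y})
    (hXstar_ne : Xstar.Nonempty)
    (a : ℕ → Fin m → Fin m → ℝ)
    (ha_nonneg : ∀ k i j, 0 ≤ a k i j)
    (ha_row : ∀ k i, ∑ j, a k i j = 1)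
    (ha_col : ∀ k j, ∑ i, a k i j = 1)
    (η : ℝ) (hη : η ∈ Set.Ioo (0:ℝ) 1)
    (ha_diag : ∀ k i, η ≤ a k i i)
    (ha_eta : ∀ k i j, 0 < a k i j → η ≤ a k i j)
    (hconn : ∀ u v : Fin m,
      Relation.ReflTransGen (fun p1 p2 => {k : ℕ | 0 < a k p2 p1}.Infinite) u v)
    (T : ℕ) (hT : 1 ≤ T)
    (hTcomm : ∀ j i : Fin m, {k : ℕ | 0 < a k i j}.Infinite →
      ∀ k : ℕ, ∃ l, k ≤ l ∧ l < k + T ∧ 0 < a l i j)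
    (c : ℕ → ℝ) (hc_pos : ∀ k, 0 < c k) (hc_anti : Antitone c)
    (hc_div : Tendsto (fun N => ∑ k ∈ Finset.range N, c k) atTop atTop)
    (hc_sq : Summable (fun k => (c k)^2))
    (x : Fin m → ℕ → EuclideanSpace ℝ (Fin n))
    (hx0 : ∀ i, x i 0 ∈ X i)
    (z : Fin m → ℕ → EuclideanSpace ℝ (Fin n))
    (hz : ∀ i k, z i k = ∑ j, a k i j • x j k)
    (hupd_mem : ∀ i k, x i (k+1) ∈ X i)
    (hupd_min : ∀ i k, ∀ y ∈ X i,
      f i (x i (k+1)) + (1/(2 * c k)) * ‖z i k - x i (k+1)‖^2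
        ≤ f i y + (1/(2 * c k)) * ‖z i k - y‖^2)
    (hupd_uniq : ∀ i k, ∀ y ∈ X i,
      f i y + (1/(2 * c k)) * ‖z i k - y‖^2
        = f i (x i (k+1)) + (1/(2 * c k)) * ‖z i k - x i (k+1)‖^2 → y = x i (k+1))
    (v : ℕ → EuclideanSpace ℝ (Fin n))
    (hv : ∀ k, v k = (m : ℝ)⁻¹ • ∑ i, x i k)
    (eps : ℕ → ℝ)
    (heps : ∀ k, eps k = ∑ i, Metric.infDist (v k) (X i))
    (vbar : ℕ → EuclideanSpace ℝ (Fin n))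
    (hvbar : ∀ k, vbar k = (eps k / (eps k + ρ)) • xbar + (ρ / (eps k + ρ)) • v k)
    :
    ∃ xstar ∈ Xstar,
      (∀ i, Tendsto (fun k => ‖x i k - xstar‖) atTop (𝓝 0)) ∧
      Tendsto (fun k => ‖v k - xstar‖) atTop (𝓝 0) ∧
      Tendsto (fun k => ‖vbar k - xstar‖) atTop (𝓝 0) := by
  subst hXstar
  have hm0 : (0 : ℝ) < m := by positivity
  have hxmem : ∀ i k, x i k ∈ X i := fun i k => by
    cases k with
    | zero => exact hx0 i
    | succ k => exact hupd_mem i k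
  -- uniform Lipschitz and boundedness constants
  have hfLip : ∀ i, LocallyLipschitz (f i) := fun i => (hfconv i).locallyLipschitz
  obtain ⟨L, hL0, hL⟩ : ∃ L : ℝ, 0 ≤ L ∧
      ∀ i, ∀ p ∈ X i, ∀ q ∈ X i, f i p - f i q ≤ L * ‖p - q‖ := by
    have h : ∀ i, ∃ C, LipschitzOnWith C (f i) (X i) := fun i =>
      (hfLip i).locallyLipschitzOn.exists_lipschitzOnWith_of_compact (hXcpt i)
    choose C hC using h
    refine ⟨∑ i, (C i : ℝ), by positivity, fun i p hp q hq => ?_⟩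
    have h1 := (hC i).dist_le_mul p hp q hq
    rw [Real.dist_eq, dist_eq_norm] at h1
    have h2 : (C i : ℝ) ≤ ∑ i, (C i : ℝ) :=
      Finset.single_le_sum (f := fun i => (C i : ℝ)) (fun j _ => (C j).2) (Finset.mem_univ i)
    exact (le_abs_self _).trans (h1.trans (by gcongr))
  obtain ⟨M, hM0, hM⟩ : ∃ M : ℝ, 0 ≤ M ∧ ∀ i k, ‖x i k - xbar‖ ≤ M := by
    obtain ⟨M, hM⟩ := (isCompact_iUnion hXcpt).isBounded.subset_closedBall xbar
    have hM' : ∀ i k, ‖x i k - xbar‖ ≤ M := fun i k =>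
      mem_closedBall_iff_norm.1 (hM (Set.mem_iUnion.2 ⟨i, hxmem i k⟩))
    exact ⟨M, (norm_nonneg _).trans (hM' ⟨0, by omega⟩ 0), hM'⟩
  have hcb : ∀ i, Metric.closedBall xbar ρ ⊆ X i := fun i => by
    rw [← closure_ball xbar hρ.ne']
    exact closure_minimal (hball.trans (Set.iInter_subset _ i)) (hXcpt i).isClosed
  -- the disagreement dominates the distance between `v` and `vbar`
  set S : ℕ → ℝ := fun k => ∑ i, ‖x i k - v k‖ with hSdef
  have hS0 : ∀ k, 0 ≤ S k := fun k => Finset.sum_nonneg fun i _ => norm_nonneg _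
  have hxS : ∀ i k, ‖x i k - v k‖ ≤ S k := fun i k =>
    Finset.single_le_sum (f := fun i => ‖x i k - v k‖) (fun i _ => norm_nonneg _)
      (Finset.mem_univ i)
  have heps0 : ∀ k, 0 ≤ eps k := fun k => by
    rw [heps]; exact Finset.sum_nonneg fun i _ => Metric.infDist_nonneg
  have hepsS : ∀ k, eps k ≤ S k := fun k => by
    rw [heps]
    refine Finset.sum_le_sum fun i _ => ?_
    rw [norm_sub_rev, ← dist_eq_norm]
    exact Metric.infDist_le_dist_of_mem (hxmem i k)
  have hvbmem : ∀ i k, vbar k ∈ X i := fun i k => by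
    obtain ⟨p, hp, hpd⟩ := (hXcpt i).exists_infDist_eq_dist (hXne i) (v k)
    rw [hvbar]
    refine (hXconv i).smul_add_smul_mem_of_norm_sub_le hρ (hcb i) hp ?_
    rw [← dist_eq_norm, ← hpd, heps]
    exact Finset.single_le_sum (f := fun i => Metric.infDist (v k) (X i))
      (fun i _ => Metric.infDist_nonneg) (Finset.mem_univ i)
  have hvM : ∀ k, ‖xbar - v k‖ ≤ M := fun k => by
    have h : v k - xbar = (m : ℝ)⁻¹ • ∑ i, (x i k - xbar) := by
      rw [hv, Finset.sum_sub_distrib, Finset.sum_const, Finset.card_univ, Fintype.card_fin,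
        smul_sub, ← Nat.cast_smul_eq_nsmul ℝ, inv_smul_smul₀ hm0.ne']
    rw [norm_sub_rev, h, norm_smul, Real.norm_of_nonneg (by positivity), inv_mul_le_iff₀ hm0]
    calc ‖∑ i, (x i k - xbar)‖ ≤ ∑ i : Fin m, M := norm_sum_le_of_le _ fun i _ => hM i k
      _ = m * M := by simp
  set R := M / ρ with hR
  have hR0 : 0 ≤ R := by positivity
  have hvvb : ∀ k, ‖v k - vbar k‖ ≤ R * S k := fun k => by
    have hne : eps k + ρ ≠ 0 := by linarith [heps0 k]
    have hone : ρ / (eps k + ρ) = 1 - eps k / (eps k + ρ) := by field_simp; ring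
    have h : vbar k - v k = (eps k / (eps k + ρ)) • (xbar - v k) := by
      rw [hvbar, hone]; module
    have h0 := heps0 k
    rw [norm_sub_rev, h, norm_smul, Real.norm_of_nonneg (by positivity)]
    calc eps k / (eps k + ρ) * ‖xbar - v k‖ ≤ eps k / ρ * M := by
          gcongr
          · linarith
          · exact hvM k
      _ = R * eps k := by rw [hR]; ring
      _ ≤ R * S k := by gcongr; exact hepsS k
  -- the consensus recursion
  set G : ℕ → ℝ := fun k => ∑ i, ‖z i k - x i (k + 1)‖ ^ 2 with hGdef
  have hG0 : ∀ k, 0 ≤ G k := fun k => Finset.sum_nonneg fun i _ => sq_nonneg _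
  set e : ℕ → ℝ := fun k => 2 * ∑ i, ‖z i k - x i (k + 1)‖ with hedef
  set y : ℕ → Fin m → EuclideanSpace ℝ (Fin n) := fun k i => x i k - v k with hydef
  set d : ℕ → Fin m → EuclideanSpace ℝ (Fin n) :=
    fun k i => (x i (k + 1) - z i k) - (v (k + 1) - v k) with hddef
  have hyrec : ∀ k i, y (k + 1) i = ∑ j, a k i j • y k j + d k i := fun k i => by
    simp only [hydef, hddef, smul_sub, Finset.sum_sub_distrib]
    rw [← Finset.sum_smul, ha_row, one_smul, ← hz]
    abel
  have hmv : ∀ k, (m : ℝ) • v k = ∑ i, x i k := fun k => by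
    rw [hv, smul_inv_smul₀ hm0.ne']
  have hysum : ∀ k, ∑ i, y k i = 0 := fun k => by
    simp only [hydef, Finset.sum_sub_distrib]
    rw [Finset.sum_const, Finset.card_univ, Fintype.card_fin, ← Nat.cast_smul_eq_nsmul ℝ, hmv,
      sub_self]
  have hzsum : ∀ k, ∑ i, z i k = ∑ i, x i k := fun k => by
    simp_rw [hz]
    rw [Finset.sum_comm]
    simp_rw [← Finset.sum_smul, ha_col, one_smul]
  have hd : ∀ k, ∑ i, ‖d k i‖ ≤ e k := fun k => by
    have h1 : (m : ℝ) • (v (k + 1) - v k) = ∑ i, (x i (k + 1) - z i k) := by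
      rw [smul_sub, hmv, hmv, Finset.sum_sub_distrib, hzsum]
    have h2 : (m : ℝ) * ‖v (k + 1) - v k‖ ≤ ∑ i, ‖z i k - x i (k + 1)‖ := by
      calc (m : ℝ) * ‖v (k + 1) - v k‖ = ‖(m : ℝ) • (v (k + 1) - v k)‖ := by
            rw [norm_smul, Real.norm_of_nonneg hm0.le]
        _ ≤ ∑ i, ‖z i k - x i (k + 1)‖ := by
            rw [h1]
            exact norm_sum_le_of_le _ fun i _ => (norm_sub_rev _ _).le
    calc ∑ i, ‖d k i‖ ≤ ∑ i, (‖z i k - x i (k + 1)‖ + ‖v (k + 1) - v k‖) :=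
          Finset.sum_le_sum fun i _ => by
            rw [norm_sub_rev (z i k)]; exact norm_sub_le _ _
      _ = ∑ i, ‖z i k - x i (k + 1)‖ + m * ‖v (k + 1) - v k‖ := by
          rw [Finset.sum_add_distrib]; simp
      _ ≤ e k := by simp only [hedef]; linarith
  have heG : ∀ k, e k ^ 2 ≤ 4 * m * G k := fun k => by
    have := sq_sum_le_card_mul_sum_sq (s := Finset.univ) (f := fun i => ‖z i k - x i (k + 1)‖)
    rw [Finset.card_univ, Fintype.card_fin] at this
    simp only [hedef, hGdef, mul_pow]
    linarith
  obtain ⟨B, hB⟩ := exists_pow_le_transitionWeights ha_nonneg hη.1 ha_diag ha_eta hconn T hTcomm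
  have hwin : ∀ k, S (k + B) ≤ (1 - m * η ^ B) * S k + ∑ t ∈ Finset.range B, e (k + t) :=
    fun k => by
      have h := sum_norm_add_le_of_le_transitionWeights ha_nonneg ha_col hyrec (hysum k) (hB k)
      rw [Fintype.card_fin] at h
      exact h.trans (by gcongr with t _; exact hd _)
  have hone : ∀ k, S (k + 1) ≤ S k + e k := fun k => by
    have h := sum_norm_add_le_of_le_transitionWeights (r := 1) (β := 0) ha_nonneg ha_col hyrec
      (hysum k) (fun i j => transitionWeights_nonneg ha_nonneg _ _ _ _)
    simp only [mul_zero, sub_zero, one_mul, Finset.sum_range_one, add_zero] at h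
    exact h.trans (by gcongr; exact hd k)
  have hq0 : 0 ≤ 1 - m * η ^ B := by
    have h : ∑ _i : Fin m, η ^ B ≤ ∑ i, transitionWeights a 0 B i ⟨0, by omega⟩ :=
      Finset.sum_le_sum fun i _ => hB 0 i _
    rw [sum_transitionWeights_col ha_col] at h
    simpa using h
  have hq1 : 1 - m * η ^ B < 1 := by
    have := hη.1
    have : 0 < m * η ^ B := by positivity
    linarith
  -- the descent inequality
  set F : EuclideanSpace ℝ (Fin n) → ℝ := fun p => ∑ i, f i p with hFdef
  set K := 2 * (L * (1 + m * R)) with hK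
  have hK0 : 0 ≤ K := by positivity
  have hdesc : ∀ u ∈ ⋂ i, X i, ∀ k, ∑ i, ‖x i (k + 1) - u‖ ^ 2 + G k +
      2 * (c k * (F (vbar (k + 1)) - F u)) ≤ ∑ i, ‖x i k - u‖ ^ 2 + K * (c k * S (k + 1)) := by
    intro u hu k
    have h1 : ∑ i, (2 * c k * (f i (x i (k + 1)) - f i u) + ‖z i k - x i (k + 1)‖ ^ 2 +
        ‖x i (k + 1) - u‖ ^ 2) ≤ ∑ i, ‖z i k - u‖ ^ 2 :=
      Finset.sum_le_sum fun i _ =>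
        ((hfconv i).subset (Set.subset_univ _) (hXconv i)).two_mul_sub_add_norm_sq_le_of_prox
          (hc_pos k) (hupd_mem i k) (hupd_min i k) (Set.mem_iInter.1 hu i)
    have h2 : ∑ i, ‖z i k - u‖ ^ 2 ≤ ∑ i, ‖x i k - u‖ ^ 2 := by
      calc ∑ i, ‖z i k - u‖ ^ 2 ≤ ∑ i, ∑ j, a k i j * ‖x j k - u‖ ^ 2 :=
            Finset.sum_le_sum fun i _ => by
              rw [hz]
              exact norm_sum_smul_sub_sq_le (ha_nonneg k i) (ha_row k i) _ _
        _ = ∑ i, ‖x i k - u‖ ^ 2 := by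
            rw [Finset.sum_comm]
            simp_rw [← Finset.sum_mul, ha_col, one_mul]
    have h3 : ∑ i, (f i (vbar (k + 1)) - f i (x i (k + 1))) ≤ L * (1 + m * R) * S (k + 1) := by
      calc ∑ i, (f i (vbar (k + 1)) - f i (x i (k + 1)))
          ≤ ∑ i, L * (‖x i (k + 1) - v (k + 1)‖ + R * S (k + 1)) := by
            refine Finset.sum_le_sum fun i _ =>
              (hL i _ (hvbmem i _) _ (hxmem i _)).trans ?_
            gcongr
            rw [norm_sub_rev]
            exact (norm_sub_le_norm_sub_add_norm_sub _ (v (k + 1)) _).trans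
              (by gcongr; exact hvvb _)
        _ = L * (1 + m * R) * S (k + 1) := by
            rw [← Finset.mul_sum, Finset.sum_add_distrib, Finset.sum_const, Finset.card_univ,
              Fintype.card_fin, nsmul_eq_mul]
            simp only [hSdef]
            ring
    rw [Finset.sum_add_distrib, Finset.sum_add_distrib, ← Finset.mul_sum,
      Finset.sum_sub_distrib] at h1
    rw [Finset.sum_sub_distrib] at h3
    have h4 := mul_le_mul_of_nonneg_left h3 (hc_pos k).le
    simp only [hFdef, hGdef, hK]
    linarith
  obtain ⟨xs, hxs, hxsmin⟩ := hXstar_ne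
  have hgap : ∀ k, 0 ≤ F (vbar k) - F xs := fun k =>
    sub_nonneg.2 (hxsmin _ (Set.mem_iInter.2 fun i => hvbmem i k))
  obtain ⟨hcS, hSlim⟩ := summable_mul_and_tendsto_zero_of_descent hS0 (fun k => (hc_pos k).le)
    hc_sq hq0 hq1 hwin hone (by positivity) heG hG0
    (D := fun k => ∑ i, ‖x i k - xs‖ ^ 2) (fun k => Finset.sum_nonneg fun i _ => sq_nonneg _) hK0
    (fun k => by
      have := mul_nonneg (hc_pos k).le (hgap (k + 1))
      linarith [hdesc xs hxs k])
  have hcS0 : ∀ k, 0 ≤ K * (c k * S (k + 1)) := fun k =>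
    mul_nonneg hK0 (mul_nonneg (hc_pos k).le (hS0 _))
  -- the optimality gap is frequently small
  have hfreq : ∀ δ > 0, ∃ᶠ k in atTop, F (vbar (k + 1)) - F xs < δ := by
    intro δ hδ
    refine frequently_lt_of_sum_mul_le (g := fun k => F (vbar (k + 1)) - F xs)
      (fun k => (hc_pos k).le) hc_div (fun k => hgap _)
      (A := ∑ i, ‖x i 0 - xs‖ ^ 2 + ∑' k, K * (c k * S (k + 1))) (fun N => ?_) hδ
    have h1 : ∑ i, ‖x i N - xs‖ ^ 2 + ∑ k ∈ Finset.range N, c k * (F (vbar (k + 1)) - F xs) ≤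
        ∑ i, ‖x i 0 - xs‖ ^ 2 + ∑ k ∈ Finset.range N, K * (c k * S (k + 1)) := by
      induction N with
      | zero => simp
      | succ N ih =>
        rw [Finset.sum_range_succ, Finset.sum_range_succ]
        have := mul_nonneg (hc_pos N).le (hgap (N + 1))
        linarith [hdesc xs hxs N, hG0 N]
    have h2 := (hcS.mul_left K).sum_le_tsum (Finset.range N) fun k _ => hcS0 k
    have h3 : 0 ≤ ∑ i, ‖x i N - xs‖ ^ 2 := Finset.sum_nonneg fun i _ => sq_nonneg _
    linarith
  obtain ⟨φ, hφ, hφlt⟩ := extraction_forall_of_frequently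
    fun l : ℕ => hfreq (1 / ((l : ℝ) + 1)) (by positivity)
  have hcpt : IsCompact (⋂ i, X i) :=
    (hXcpt ⟨0, by omega⟩).of_isClosed_subset (isClosed_iInter fun i => (hXcpt i).isClosed)
      (Set.iInter_subset _ _)
  obtain ⟨p, hp, ψ, hψ, hψlim⟩ := hcpt.tendsto_subseq (x := fun l => vbar (φ l + 1))
    fun l => Set.mem_iInter.2 fun i => hvbmem i _
  have hFcont : Continuous F := continuous_finsetSum _ fun i _ => (hfLip i).continuous
  have hFp : F p ≤ F xs := by
    have h1 : Tendsto (fun l => F (vbar (φ (ψ l) + 1)) - F xs) atTop (𝓝 (F p - F xs)) :=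
      ((hFcont.tendsto p).comp hψlim).sub_const _
    have h2 : Tendsto (fun l : ℕ => 1 / ((ψ l : ℝ) + 1)) atTop (𝓝 0) :=
      tendsto_one_div_add_atTop_nhds_zero_nat.comp hψ.tendsto_atTop
    linarith [le_of_tendsto_of_tendsto' h1 h2 fun l => (hφlt (ψ l)).le]
  have hpmin : ∀ u ∈ ⋂ i, X i, F p ≤ F u := fun u hu => hFp.trans (hxsmin u hu)
  -- the iterates approach `p` along the subsequence, hence along the whole sequence
  have hσ : Tendsto (fun l => φ (ψ l) + 1) atTop atTop :=
    (tendsto_add_atTop_nat 1).comp ((hφ.comp hψ).tendsto_atTop)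
  have hxvb : ∀ i, Tendsto (fun k => x i k - vbar k) atTop (𝓝 0) := fun i => by
    refine squeeze_zero_norm (a := fun k => (1 + R) * S k) (fun k => ?_)
      (by simpa using hSlim.const_mul (1 + R))
    have := norm_sub_le_norm_sub_add_norm_sub (x i k) (v k) (vbar k)
    linarith [hxS i k, hvvb k]
  have hDsub : Tendsto (fun l => ∑ i, ‖x i (φ (ψ l) + 1) - p‖ ^ 2) atTop (𝓝 0) := by
    have h : ∀ i, Tendsto (fun l => ‖x i (φ (ψ l) + 1) - p‖ ^ 2) atTop (𝓝 0) := fun i => by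
      have h1 := (((hxvb i).comp hσ).add hψlim).sub_const p
      simpa using h1.norm.pow 2
    simpa using tendsto_finsetSum Finset.univ fun i _ => h i
  have hDlim : Tendsto (fun k => ∑ i, ‖x i k - p‖ ^ 2) atTop (𝓝 0) := by
    refine tendsto_zero_of_frequently_lt (w := fun k => K * (c k * S (k + 1)))
      (fun k => Finset.sum_nonneg fun i _ => sq_nonneg _) hcS0 (hcS.mul_left K) (fun k => ?_)
      fun δ hδ => ?_
    · have h1 := hpmin _ (Set.mem_iInter.2 fun i => hvbmem i (k + 1))
      have h2 := mul_nonneg (hc_pos k).le (sub_nonneg.2 h1)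
      linarith [hdesc p hp k, hG0 k]
    · exact hσ.frequently (hDsub.eventually_lt_const hδ).frequently
  have hxlim : ∀ i, Tendsto (fun k => ‖x i k - p‖) atTop (𝓝 0) := fun i => by
    have h : Tendsto (fun k => ‖x i k - p‖ ^ 2) atTop (𝓝 0) :=
      squeeze_zero (fun k => sq_nonneg _) (fun k =>
        Finset.single_le_sum (f := fun i => ‖x i k - p‖ ^ 2) (fun i _ => sq_nonneg _)
          (Finset.mem_univ i)) hDlim
    simpa using h.sqrt
  have hvlim : Tendsto (fun k => ‖v k - p‖) atTop (𝓝 0) := by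
    refine squeeze_zero (g := fun k => S k + ‖x ⟨0, by omega⟩ k - p‖) (fun k => norm_nonneg _)
      (fun k => ?_) (by simpa using hSlim.add (hxlim ⟨0, by omega⟩))
    have := norm_sub_le_norm_sub_add_norm_sub (v k) (x ⟨0, by omega⟩ k) p
    rw [norm_sub_rev (v k) (x _ k)] at this
    linarith [hxS ⟨0, by omega⟩ k]
  refine ⟨p, ⟨hp, hpmin⟩, hxlim, hvlim, ?_⟩
  refine squeeze_zero (g := fun k => R * S k + ‖v k - p‖) (fun k => norm_nonneg _)
    (fun k => ?_) (by simpa using (hSlim.const_mul R).add hvlim)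
  have := norm_sub_le_norm_sub_add_norm_sub (vbar k) (v k) p
  rw [norm_sub_rev (vbar k) (v k)] at this
  linarith [hvvb k]
end
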